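/- Let (u,v) be a positive radial C² solution of the system on [0,ρ) with central values (a,b), a,b > 0, and with u and v nondecreasing on [0,ρ). Then for every r ∈ [0,ρ): g(v(r)) ≤ g(f(u(r))) · g(b/f(a) + L_q) and f(u(r)) ≤ f(g(v(r))) · f(a/g(b) + L_p). -/

import Mathlib

open MeasureTheory Set Filter Topology

noncomputable section

/-- The iterated radial kernel
`∫₀^r t^{1-n} ∫₀^t s^{n-1} w(s) h(φ(s)) ds dt`. -/
def radK (n : ℕ) (w h φ : ℝ → ℝ) (r : ℝ) : ℝ :=
  ∫ t in (0:ℝ)..r, t ^ (1 - (n : ℤ)) *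
    ∫ s in (0:ℝ)..t, s ^ ((n : ℤ) - 1) * w s * h (φ s)

/-- Hypothesis (F1). -/
def hypF1 (f g : ℝ → ℝ) : Prop :=
  ContinuousOn f (Ici 0) ∧ ContinuousOn g (Ici 0) ∧
  DifferentiableOn ℝ f (Ioi 0) ∧ DifferentiableOn ℝ g (Ioi 0) ∧
  MonotoneOn f (Ici 0) ∧ MonotoneOn g (Ici 0) ∧
  f 0 = 0 ∧ g 0 = 0 ∧ (∀ s : ℝ, 0 < s → 0 < f s) ∧ (∀ s : ℝ, 0 < s → 0 < g s)

/-- Hypothesis (F2): multiplicative subadditivity. -/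
def hypF2 (f g : ℝ → ℝ) : Prop :=
  (∀ s : ℝ, 0 ≤ s → ∀ r : ℝ, 0 ≤ r → f (s * r) ≤ f s * f r) ∧
  (∀ l : ℝ, 0 ≤ l → ∀ t : ℝ, 0 ≤ t → g (l * t) ≤ g l * g t)

/-- Hypothesis (F3): finite Keller–Osserman integrals. -/
def hypF3 (f g : ℝ → ℝ) : Prop :=
  IntegrableOn (fun t : ℝ => 1 / Real.sqrt (∫ z in (0:ℝ)..t, g (f z))) (Ioi 1) ∧
  IntegrableOn (fun t : ℝ => 1 / Real.sqrt (∫ z in (0:ℝ)..t, f (g z))) (Ioi 1)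

/-- Hypothesis (PQ). -/
def hypPQ (p q : ℝ → ℝ) : Prop :=
  ContinuousOn p (Ici 0) ∧ ContinuousOn q (Ici 0) ∧
  (∀ s : ℝ, 0 ≤ s → 0 ≤ p s) ∧ (∀ s : ℝ, 0 ≤ s → 0 ≤ q s) ∧
  (¬ ∀ s : ℝ, 0 ≤ s → p s = 0 ∧ q s = 0) ∧
  IntegrableOn (fun s : ℝ => s * p s) (Ioi 0) ∧
  IntegrableOn (fun s : ℝ => s * q s) (Ioi 0) ∧
  ¬ ∃ R : ℝ, ∀ s : ℝ, R ≤ s → min (p s) (q s) = 0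

/-- `L_w = (1/(n-2)) ∫₀^∞ s w(s) ds`. -/
def Lcoef (n : ℕ) (w : ℝ → ℝ) : ℝ := (1 / ((n : ℝ) - 2)) * ∫ s in Ioi (0:ℝ), s * w s

/-- Keller–Osserman transform `Φ(t) = ∫_t^∞ ds / g(f(s))`. -/
def PhiKO (f g : ℝ → ℝ) (t : ℝ) : ℝ := ∫ s in Ioi t, 1 / g (f s)

/-- Keller–Osserman transform `Ψ(t) = ∫_t^∞ ds / f(g(s))`. -/
def PsiKO (f g : ℝ → ℝ) (t : ℝ) : ℝ := ∫ s in Ioi t, 1 / f (g s)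

/-- Positive radial `C²` solution (integral form) on `[0, ρ)` with central values `(a,b)`. -/
def IsRadSol (n : ℕ) (p q f g : ℝ → ℝ) (a b ρ : ℝ) (u v : ℝ → ℝ) : Prop :=
  ContDiffOn ℝ 2 u (Ico 0 ρ) ∧ ContDiffOn ℝ 2 v (Ico 0 ρ) ∧
  (∀ r ∈ Ico (0:ℝ) ρ, 0 < u r ∧ 0 < v r) ∧
  (∀ r ∈ Ico (0:ℝ) ρ, u r = a + radK n p g v r) ∧
  (∀ r ∈ Ico (0:ℝ) ρ, v r = b + radK n q f u r)

/-- Positive radial `C²` solution (integral form) on the closed interval `[0, R]`. -/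
def IsRadSolIcc (n : ℕ) (p q f g : ℝ → ℝ) (a b R : ℝ) (u v : ℝ → ℝ) : Prop :=
  ContDiffOn ℝ 2 u (Icc 0 R) ∧ ContDiffOn ℝ 2 v (Icc 0 R) ∧
  (∀ r ∈ Icc (0:ℝ) R, 0 < u r ∧ 0 < v r) ∧
  (∀ r ∈ Icc (0:ℝ) R, u r = a + radK n p g v r) ∧
  (∀ r ∈ Icc (0:ℝ) R, v r = b + radK n q f u r)

/-- Entire positive radial `C²` solution (integral form) with central values `(a,b)`. -/
def IsEntireRadSol (n : ℕ) (p q f g : ℝ → ℝ) (a b : ℝ) (u v : ℝ → ℝ) : Prop :=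
  ContDiffOn ℝ 2 u (Ici 0) ∧ ContDiffOn ℝ 2 v (Ici 0) ∧
  (∀ r ∈ Ici (0:ℝ), 0 < u r ∧ 0 < v r) ∧
  (∀ r ∈ Ici (0:ℝ), u r = a + radK n p g v r) ∧
  (∀ r ∈ Ici (0:ℝ), v r = b + radK n q f u r)

/-- Positive `C²` solution of the radial ODE system on `[0, ρ)` with central values `(a,b)`. -/
def IsRadODESol (n : ℕ) (p q f g : ℝ → ℝ) (a b ρ : ℝ) (u v : ℝ → ℝ) : Prop :=
  ContDiffOn ℝ 2 u (Ico 0 ρ) ∧ ContDiffOn ℝ 2 v (Ico 0 ρ) ∧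
  (∀ r ∈ Ico (0:ℝ) ρ, 0 < u r ∧ 0 < v r) ∧
  u 0 = a ∧ v 0 = b ∧ deriv u 0 = 0 ∧ deriv v 0 = 0 ∧
  (∀ r ∈ Ioo (0:ℝ) ρ,
    deriv (deriv u) r + ((n : ℝ) - 1) / r * deriv u r = p r * g (v r) ∧
    deriv (deriv v) r + ((n : ℝ) - 1) / r * deriv v r = q r * f (u r))

/-- The set `S` of central values admitting an entire positive radial solution. -/
def centralSet (n : ℕ) (p q f g : ℝ → ℝ) : Set (ℝ × ℝ) :=
  {ab : ℝ × ℝ | 0 ≤ ab.1 ∧ 0 ≤ ab.2 ∧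
    ∃ u v : ℝ → ℝ, IsEntireRadSol n p q f g ab.1 ab.2 u v}

/-- The set of radii `ρ > 0` on which a positive solution of the radial ODE system exists. -/
def odeSolSet (n : ℕ) (p q f g : ℝ → ℝ) (a b : ℝ) : Set ℝ :=
  {ρ : ℝ | 0 < ρ ∧ ∃ u v : ℝ → ℝ, IsRadODESol n p q f g a b ρ u v}

end


lemma aux_outer (m : ℕ) (hm : 1 ≤ m) (w : ℝ → ℝ) (hw : Continuous w)
    (hw0 : ∀ s, 0 ≤ w s) (H : ℝ) (hH : 0 ≤ H) (r : ℝ) (hr : 0 ≤ r) (φ : ℝ → ℝ)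
    (hφ : IntegrableOn φ (Icc 0 r))
    (hle : ∀ t ∈ Ioo 0 r, φ t ≤ (t ^ (m+1))⁻¹ * (H * ∫ s in (0:ℝ)..t, s ^ (m+1) * w s)) :
    ∫ t in (0:ℝ)..r, φ t ≤ H * ((1 / (m:ℝ)) * ∫ s in (0:ℝ)..r, s * w s) := by
  have hm0 : (0:ℝ) < m := by exact_mod_cast hm
  set I : ℝ → ℝ := fun t => ∫ s in (0:ℝ)..t, s ^ (m+1) * w s with hI
  set J : ℝ → ℝ := fun t => ∫ s in (0:ℝ)..t, s * w s with hJ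
  have hIc : Continuous (fun s : ℝ => s ^ (m+1) * w s) := by fun_prop
  have hJc : Continuous (fun s : ℝ => s * w s) := by fun_prop
  have dI : ∀ t, HasDerivAt I (t ^ (m+1) * w t) t := fun t =>
    intervalIntegral.integral_hasDerivAt_right (hIc.intervalIntegrable _ _)
      (hIc.stronglyMeasurableAtFilter _ _) hIc.continuousAt
  have dJ : ∀ t, HasDerivAt J (t * w t) t := fun t =>
    intervalIntegral.integral_hasDerivAt_right (hJc.intervalIntegrable _ _)
      (hJc.stronglyMeasurableAtFilter _ _) hJc.continuousAt
  have I0 : I 0 = 0 := by simp [hI]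
  have J0 : J 0 = 0 := by simp [hJ]
  have hInn : ∀ t, 0 ≤ t → 0 ≤ I t := fun t ht =>
    intervalIntegral.integral_nonneg ht (fun s hs => mul_nonneg (pow_nonneg hs.1 _) (hw0 s))
  have hIJ : ∀ t, 0 ≤ t → I t ≤ t ^ m * J t := by
    intro t ht
    rw [hI, hJ]
    simp only
    rw [← intervalIntegral.integral_const_mul]
    apply intervalIntegral.integral_mono_on ht (hIc.intervalIntegrable _ _)
      ((continuous_const.mul hJc).intervalIntegrable _ _)
    intro s hs
    have h1 : s ^ m ≤ t ^ m := pow_le_pow_left₀ hs.1 hs.2 m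
    have := mul_le_mul_of_nonneg_right h1 (mul_nonneg hs.1 (hw0 s))
    calc _ = s ^ m * (s * w s) := by ring
      _ ≤ _ := this
  set G : ℝ → ℝ := fun t => H * ((1 / (m:ℝ)) * (J t - I t / t ^ m)) with hG
  have dG : ∀ t, 0 < t → HasDerivAt G ((t ^ (m+1))⁻¹ * (H * I t)) t := by
    intro t ht
    have h := (((dJ t).sub ((dI t).div (hasDerivAt_pow m t) (pow_pos ht m).ne')).const_mul
      (1 / (m:ℝ))).const_mul H
    refine h.congr_deriv ?_
    obtain ⟨k, rfl⟩ := Nat.exists_eq_add_of_le' hm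
    simp only [Nat.add_sub_cancel]
    have : t ≠ 0 := ht.ne'
    have : ((k + 1 : ℕ) : ℝ) ≠ 0 := hm0.ne'
    field_simp
    ring
  have cG : ContinuousOn G (Icc 0 r) := by
    intro t ht
    rcases ht.1.eq_or_lt with h | h
    · subst h
      have hlim : Tendsto (fun t => I t / t ^ m) (𝓝[Icc 0 r] 0) (𝓝 0) := by
        have hJt : Tendsto J (𝓝[Icc 0 r] 0) (𝓝 0) := by
          have := (dJ 0).continuousAt.tendsto
          rw [J0] at this
          exact this.mono_left nhdsWithin_le_nhds
        apply tendsto_of_tendsto_of_tendsto_of_le_of_le' tendsto_const_nhds hJt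
        · filter_upwards [self_mem_nhdsWithin] with t ht
          exact div_nonneg (hInn t ht.1) (pow_nonneg ht.1 m)
        · filter_upwards [self_mem_nhdsWithin] with t ht
          rcases ht.1.eq_or_lt with h | h
          · subst h; simp [I0, J0]
          · rw [div_le_iff₀ (pow_pos h m), mul_comm]
            exact hIJ t ht.1
      have hc : ContinuousWithinAt (fun t => I t / t ^ m) (Icc 0 r) 0 := by
        unfold ContinuousWithinAt
        simpa [I0] using hlim
      exact (((dJ 0).continuousAt.continuousWithinAt.sub hc).const_mul _).const_mul _
    · exact (dG t h).continuousAt.continuousWithinAt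
  have key := intervalIntegral.integral_le_sub_of_hasDeriv_right_of_le hr cG
    (fun x hx => (dG x hx.1).hasDerivWithinAt) hφ hle
  refine key.trans ?_
  have : G 0 = 0 := by simp [hG, I0, J0]
  rw [this, sub_zero, hG]
  simp only
  have : 0 ≤ I r / r ^ m := div_nonneg (hInn r hr) (pow_nonneg hr m)
  gcongr
  linarith

lemma radK_le (n : ℕ) (hn : 3 ≤ n) (w h φ : ℝ → ℝ) (r : ℝ) (hr : 0 ≤ r)
    (hw : ContinuousOn w (Ici 0)) (hw0 : ∀ s, 0 ≤ s → 0 ≤ w s)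
    (hwi : IntegrableOn (fun s : ℝ => s * w s) (Ioi 0))
    (hc : ContinuousOn (fun s => h (φ s)) (Icc 0 r))
    (hmono : ∀ s ∈ Icc 0 r, h (φ s) ≤ h (φ r)) (hH : 0 ≤ h (φ r)) :
    radK n w h φ r ≤ h (φ r) * Lcoef n w := by
  obtain ⟨m, rfl⟩ := Nat.exists_eq_add_of_le' (show 2 ≤ n by omega)
  have hm : 1 ≤ m := by omega
  have hm0 : (0:ℝ) < m := by exact_mod_cast hm
  have hL : (1 / (m:ℝ)) * ∫ s in (0:ℝ)..r, s * w s ≤ Lcoef (m+2) w := by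
    unfold Lcoef
    have : (((m + 2 : ℕ) : ℝ) - 2) = m := by push_cast; ring
    rw [this, intervalIntegral.integral_of_le hr]
    apply mul_le_mul_of_nonneg_left _ (by positivity)
    apply setIntegral_mono_set hwi
    · filter_upwards [ae_restrict_mem measurableSet_Ioi] with s hs
      exact mul_nonneg (le_of_lt hs) (hw0 s (le_of_lt hs))
    · exact Ioc_subset_Ioi_self.eventuallyLE
  have hJ0 : 0 ≤ ∫ s in (0:ℝ)..r, s * w s :=
    intervalIntegral.integral_nonneg hr (fun s hs => mul_nonneg hs.1 (hw0 s hs.1))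
  refine le_trans ?_ (mul_le_mul_of_nonneg_left hL hH)
  unfold radK
  by_cases hint : IntervalIntegrable (fun t : ℝ => t ^ (1 - ((m+2 : ℕ) : ℤ)) *
    ∫ s in (0:ℝ)..t, s ^ (((m+2 : ℕ) : ℤ) - 1) * w s * h (φ s)) volume 0 r
  swap
  · rw [intervalIntegral.integral_undef hint]
    positivity
  have hcw : Continuous (fun s => w (max s 0)) := by
    apply hw.comp_continuous (by fun_prop)
    intro s; exact mem_Ici.2 (le_max_right _ _)
  have e1 : (((m+2 : ℕ) : ℤ) - 1) = ((m+1 : ℕ) : ℤ) := by push_cast; ring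
  have e2 : (1 - ((m+2 : ℕ) : ℤ)) = -((m+1 : ℕ) : ℤ) := by push_cast; ring
  have := aux_outer m hm (fun s => w (max s 0)) hcw (fun s => hw0 _ (le_max_right _ _))
    (h (φ r)) hH r hr _ ((intervalIntegrable_iff_integrableOn_Icc_of_le hr).1 hint) ?_
  · refine this.trans (le_of_eq ?_)
    congr 2
    apply intervalIntegral.integral_congr
    intro s hs
    rw [uIcc_of_le hr] at hs
    simp only [max_eq_left hs.1]
  · intro t ht
    rw [e1, e2, zpow_neg, zpow_natCast]
    apply mul_le_mul_of_nonneg_left _ (inv_nonneg.2 (pow_nonneg ht.1.le _))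
    rw [← intervalIntegral.integral_const_mul]
    apply intervalIntegral.integral_mono_on ht.1.le
    · apply ContinuousOn.intervalIntegrable
      rw [uIcc_of_le ht.1.le]
      simp only [zpow_natCast]
      exact ((by fun_prop : Continuous fun s : ℝ => s ^ (m+1)).continuousOn.mul
        (hw.mono Icc_subset_Ici_self)).mul (hc.mono (Icc_subset_Icc_right ht.2.le))
    · apply Continuous.intervalIntegrable
      exact continuous_const.mul ((continuous_pow (m+1)).mul hcw)
    · intro s hs
      rw [zpow_natCast, max_eq_left hs.1, mul_comm]
      exact mul_le_mul_of_nonneg_right (hmono s ⟨hs.1, hs.2.trans ht.2.le⟩)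
        (mul_nonneg (pow_nonneg hs.1 _) (hw0 s hs.1))

lemma half_bound (n : ℕ) (hn : 3 ≤ n) (f g q : ℝ → ℝ)
    (hfc : ContinuousOn f (Ici 0)) (hf : MonotoneOn f (Ici 0)) (hg : MonotoneOn g (Ici 0))
    (hfp : ∀ s : ℝ, 0 < s → 0 < f s)
    (hg2 : ∀ l : ℝ, 0 ≤ l → ∀ t : ℝ, 0 ≤ t → g (l * t) ≤ g l * g t)
    (hw : ContinuousOn q (Ici 0)) (hw0 : ∀ s, 0 ≤ s → 0 ≤ q s)
    (hwi : IntegrableOn (fun s : ℝ => s * q s) (Ioi 0))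
    (a b ρ : ℝ) (ha : 0 < a) (hb : 0 < b) (u v : ℝ → ℝ)
    (huc : ContinuousOn u (Ico 0 ρ)) (hu : MonotoneOn u (Ico 0 ρ))
    (hup : ∀ r ∈ Ico (0:ℝ) ρ, 0 < u r) (hvp : ∀ r ∈ Ico (0:ℝ) ρ, 0 < v r)
    (hu0 : ∀ r ∈ Ico (0:ℝ) ρ, a ≤ u r)
    (hv : ∀ r ∈ Ico (0:ℝ) ρ, v r = b + radK n q f u r) (r : ℝ) (hr : r ∈ Ico (0:ℝ) ρ) :
    g (v r) ≤ g (f (u r)) * g (b / f a + Lcoef n q) := by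
  have hsub : Icc 0 r ⊆ Ico 0 ρ := fun s hs => ⟨hs.1, hs.2.trans_lt hr.2⟩
  have hK := radK_le n hn q f u r hr.1 hw hw0 hwi
    (hfc.comp (huc.mono hsub) (fun s hs => (hup s (hsub hs)).le))
    (fun s hs => hf (hup s (hsub hs)).le (hup r hr).le (hu (hsub hs) hr hs.2))
    (hfp _ (hup r hr)).le
  have hfa := hfp a ha
  have hfu := hfp _ (hup r hr)
  have hL : 0 ≤ Lcoef n q := by
    have h3 : (3:ℝ) ≤ n := by exact_mod_cast hn
    exact mul_nonneg (one_div_nonneg.2 (by linarith))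
      (setIntegral_nonneg measurableSet_Ioi
        (fun s hs => mul_nonneg (le_of_lt hs) (hw0 s (le_of_lt hs))))
  have hB : b ≤ f (u r) * (b / f a) := by
    have : f a ≤ f (u r) := hf ha.le (hup r hr).le (hu0 r hr)
    rw [← mul_div_assoc, le_div_iff₀ hfa]
    nlinarith
  have hsum : 0 ≤ b / f a + Lcoef n q := by positivity
  have hle : v r ≤ f (u r) * (b / f a + Lcoef n q) := by
    rw [hv r hr, mul_add]; linarith
  exact (hg (hvp r hr).le (mul_nonneg hfu.le hsum) hle).trans (hg2 _ hfu.le _ hsum)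

/-- multiplicative pointwise bounds for monotone solutions. -/
theorem multiplicative_pointwise_bounds
    (n : ℕ) (hn : 3 ≤ n) (f g p q : ℝ → ℝ)
    (hF1 : hypF1 f g) (hF2 : hypF2 f g) (hPQ : hypPQ p q)
    (a b ρ : ℝ) (ha : 0 < a) (hb : 0 < b)
    (u v : ℝ → ℝ) (hsol : IsRadSol n p q f g a b ρ u v)
    (hu : MonotoneOn u (Ico 0 ρ)) (hv : MonotoneOn v (Ico 0 ρ)) :
    ∀ r ∈ Ico (0:ℝ) ρ,
      g (v r) ≤ g (f (u r)) * g (b / f a + Lcoef n q) ∧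
      f (u r) ≤ f (g (v r)) * f (a / g b + Lcoef n p) := by
  obtain ⟨fc, gc, -, -, fm, gm, -, -, fp, gp⟩ := hF1
  obtain ⟨f2, g2⟩ := hF2
  obtain ⟨pc, qc, p0, q0, -, pI, qI, -⟩ := hPQ
  obtain ⟨uc, vc, pos, hue, hve⟩ := hsol
  have z : ∀ r ∈ Ico (0:ℝ) ρ, (0:ℝ) ∈ Ico (0:ℝ) ρ := fun r hr => ⟨le_rfl, hr.1.trans_lt hr.2⟩
  have hua : ∀ r ∈ Ico (0:ℝ) ρ, a ≤ u r := fun r hr => by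
    have h0 := hue 0 (z r hr)
    simp only [radK, intervalIntegral.integral_same, add_zero] at h0
    exact h0 ▸ hu (z r hr) hr hr.1
  have hvb : ∀ r ∈ Ico (0:ℝ) ρ, b ≤ v r := fun r hr => by
    have h0 := hve 0 (z r hr)
    simp only [radK, intervalIntegral.integral_same, add_zero] at h0
    exact h0 ▸ hv (z r hr) hr hr.1
  intro r hr
  exact ⟨half_bound n hn f g q fc fm gm fp g2 qc q0 qI a b ρ ha hb u v uc.continuousOn hu
      (fun r hr => (pos r hr).1) (fun r hr => (pos r hr).2) hua hve r hr,
    half_bound n hn g f p gc gm fm gp f2 pc p0 pI b a ρ hb ha v u vc.continuousOn hv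
      (fun r hr => (pos r hr).2) (fun r hr => (pos r hr).1) hvb hue r hr⟩
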